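/- arXiv:math/0312073 — 8 statements merged into one kernel-verified Lean document; each statement's English description precedes it below -/
import Mathlib

section
/- Let N be a unital associative algebra over ℂ, A a subalgebra of N, T ∈ N a fixed element, and δ_1,…,δ_k : A → N ℂ-linear maps satisfying the Leibniz rule δ_i(ab) = δ_i(a)·b + a·δ_i(b) for all a,b ∈ A. Let φ : N → ℂ be ℂ-linear and define the (k+1)-multilinear functional φ̃ on A by φ̃(a_0,…,a_k) = φ(a_0·δ_1(a_1)⋯δ_k(a_k)·T). Then for all a_0,…,a_{k+1} ∈ A the Hochschild coboundary of φ̃ satisfies: φ̃(a_0a_1, a_2,…,a_{k+1}) + Σ_{i=1}^{k} (−1)^i φ̃(a_0,…,a_{i−1}, a_i a_{i+1}, a_{i+2},…,a_{k+1}) + (−1)^{k+1} φ̃(a_{k+1}a_0, a_1,…,a_k) = (−1)^k · φ( a_0·δ_1(a_1)⋯δ_k(a_k)·a_{k+1}·T − a_{k+1}·a_0·δ_1(a_1)⋯δ_k(a_k)·T ). -/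
theorem Fin.contractNth_zero_apply_zero {α : Type*} {n : ℕ} (op : α → α → α)
    (a : Fin (n + 2) → α) : Fin.contractNth 0 op a 0 = op (a 0) (a 1) := by
  simp [Fin.contractNth]

theorem Fin.contractNth_zero_apply_succ {α : Type*} {n : ℕ} (op : α → α → α)
    (a : Fin (n + 2) → α) (j : Fin n) : Fin.contractNth 0 op a j.succ = a j.succ.succ := by
  simp [Fin.contractNth]

theorem Fin.contractNth_succ_apply_zero {α : Type*} {n : ℕ} (i : Fin (n + 1)) (op : α → α → α)
    (a : Fin (n + 2) → α) : Fin.contractNth i.succ op a 0 = a 0 := by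
  simp [Fin.contractNth]

theorem Fin.contractNth_succ_apply_succ {α : Type*} {n : ℕ} (i : Fin (n + 1)) (op : α → α → α)
    (a : Fin (n + 2) → α) (j : Fin n) :
    Fin.contractNth i.succ op a j.succ = Fin.contractNth i op (fun l => a l.succ) j := by
  simp [Fin.contractNth]

/-- Telescoping identity for products of derivations evaluated on contracted tuples. -/
theorem Subalgebra.sum_contractNth_prod_derivation {R N : Type*} [CommRing R] [Ring N]
    [Algebra R N] (A : Subalgebra R N) (k : ℕ) (δ : Fin k → (A →ₗ[R] N))
    (hδ : ∀ (i : Fin k) (a b : A), δ i (a * b) = δ i a * (b : N) + (a : N) * δ i b)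
    (a : Fin (k + 1) → A) :
    (a 0 : N) * (List.ofFn fun i : Fin k => δ i (a i.succ)).prod
      - ∑ i : Fin k, (-1 : R) ^ (i : ℕ) •
          (List.ofFn fun j : Fin k => δ j (Fin.contractNth i.castSucc (· * ·) a j)).prod
    = (-1 : R) ^ k •
        ((List.ofFn fun i : Fin k => δ i (a i.castSucc)).prod * (a (Fin.last k) : N)) := by
  induction k with
  | zero => simp
  | succ k ih =>
    have h := ih (fun i => δ i.succ) (fun i => hδ i.succ) (fun i => a i.succ)
    rw [Fin.sum_univ_succ]
    simp only [List.ofFn_succ, List.prod_cons, Fin.castSucc_zero, ← Fin.succ_castSucc,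
      Fin.contractNth_zero_apply_zero, Fin.contractNth_zero_apply_succ,
      Fin.contractNth_succ_apply_zero, Fin.contractNth_succ_apply_succ, hδ, Fin.val_zero,
      Fin.val_succ, pow_succ, pow_zero, one_smul, mul_neg_one, neg_smul, Finset.sum_neg_distrib,
      ← mul_smul_comm, ← Finset.mul_sum, Fin.succ_zero_eq_one, ← Fin.succ_last, mul_assoc]
      at h ⊢
    simp only [mul_neg, ← h]
    noncomm_ring

/-- Let `N` be a unital associative algebra over `ℂ`, `A` a subalgebra,
`T ∈ N`, and `δ_1, …, δ_k : A → N` be `ℂ`-linear derivations (Leibniz rule).  Let `φ : N → ℂ`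
be `ℂ`-linear and define `φ̃(a_0,…,a_k) = φ(a_0 · δ_1(a_1) ⋯ δ_k(a_k) · T)`.  Then the
Hochschild coboundary of `φ̃` satisfies
`(bφ̃)(a_0,…,a_{k+1}) = (−1)^k φ(a_0 δ_1(a_1)⋯δ_k(a_k) a_{k+1} T − a_{k+1} a_0 δ_1(a_1)⋯δ_k(a_k) T)`. -/
theorem hochschild_coboundary_of_derivation_functional
    (N : Type*) [Ring N] [Algebra ℂ N] (A : Subalgebra ℂ N) (T : N)
    (k : ℕ) (δ : Fin k → (A →ₗ[ℂ] N))
    (hLeibniz : ∀ (i : Fin k) (a b : A), δ i (a * b) = δ i a * (b : N) + (a : N) * δ i b)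
    (φ : N →ₗ[ℂ] ℂ)
    (φt : (Fin (k + 1) → A) → ℂ)
    (hφt : ∀ a : Fin (k + 1) → A,
      φt a = φ ((a 0 : N) * (List.ofFn fun i : Fin k => δ i (a i.succ)).prod * T))
    (a : Fin (k + 2) → A) :
    (∑ i : Fin (k + 1), (-1 : ℂ) ^ (i : ℕ) * φt (Fin.contractNth i.castSucc (· * ·) a))
      + (-1 : ℂ) ^ (k + 1) *
        φt (fun j : Fin (k + 1) =>
          if j = 0 then a (Fin.last (k + 1)) * a 0 else a j.castSucc)
    = (-1 : ℂ) ^ k *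
        φ ((a 0 : N) * (List.ofFn fun i : Fin k => δ i (a i.succ.castSucc)).prod
              * (a (Fin.last (k + 1)) : N) * T
            - (a (Fin.last (k + 1)) : N) * (a 0 : N)
              * (List.ofFn fun i : Fin k => δ i (a i.succ.castSucc)).prod * T) := by
  have h := congrArg (fun x => φ ((a 0 : N) * x * T))
    (A.sum_contractNth_prod_derivation k δ hLeibniz (fun i => a i.succ))
  rw [Fin.sum_univ_succ]
  simp only [hφt, Fin.castSucc_zero, ← Fin.succ_castSucc,
    Fin.contractNth_zero_apply_zero, Fin.contractNth_zero_apply_succ,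
    Fin.contractNth_succ_apply_zero, Fin.contractNth_succ_apply_succ, Fin.val_zero,
    Fin.val_succ, pow_succ, pow_zero, one_mul, mul_neg_one, neg_mul, Finset.sum_neg_distrib,
    if_true, Fin.succ_ne_zero, if_false, mul_sub, sub_mul, map_sub, Finset.mul_sum,
    Finset.sum_mul, map_sum, mul_smul_comm, smul_mul_assoc, map_smul, smul_eq_mul,
    Fin.succ_zero_eq_one, Fin.succ_last, MulMemClass.coe_mul, mul_assoc] at h ⊢
  linear_combination h
end

section
/- For every integer p ≥ 1 and every real x ≥ 0, one has √(1 − erf_p(x)) ≤ 2^{p/4} · e^{−x²/4}. -/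
open MeasureTheory

/-- The constant `c(p) = p / Γ(p/2 + 1)`. -/
noncomputable def cP (p : ℕ) : ℝ := p / Real.Gamma ((p : ℝ) / 2 + 1)

/-- The generalized error function `erf_p(x) = c(p) ∫_0^x r^{p-1} e^{-r²} dr`. -/
noncomputable def erfP (p : ℕ) (x : ℝ) : ℝ :=
  cP p * ∫ r in (0 : ℝ)..x, r ^ (p - 1) * Real.exp (-r ^ 2)

/-- The moments of a centred Gaussian on the half-line, normalised by `cP`. -/
theorem cP_mul_integral_pow_mul_exp_neg_mul_sq {p : ℕ} (hp : 1 ≤ p) {b : ℝ} (hb : 0 < b) :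
    cP p * ∫ r in Set.Ioi (0 : ℝ), r ^ (p - 1) * Real.exp (-b * r ^ 2) =
      b ^ (-((p : ℝ) / 2)) := by
  have hp' : (0 : ℝ) < p := by exact_mod_cast hp
  have h := integral_rpow_mul_exp_neg_mul_rpow (p := 2) (q := ((p - 1 : ℕ) : ℝ)) (b := b)
    two_pos (by linarith [Nat.cast_nonneg (α := ℝ) (p - 1)]) hb
  simp only [Real.rpow_natCast, Real.rpow_ofNat] at h
  rw [h, cP, Nat.cast_sub hp, Nat.cast_one, sub_add_cancel, neg_div,
    Real.Gamma_add_one (by positivity)]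
  have hG : Real.Gamma ((p : ℝ) / 2) ≠ 0 := (Real.Gamma_pos_of_pos (by positivity)).ne'
  field_simp

theorem integrableOn_pow_mul_exp_neg_mul_sq (n : ℕ) {b : ℝ} (hb : 0 < b) :
    IntegrableOn (fun r : ℝ ↦ r ^ n * Real.exp (-b * r ^ 2)) (Set.Ioi 0) := by
  have h := integrableOn_rpow_mul_exp_neg_mul_sq hb (s := (n : ℝ))
    (by linarith [Nat.cast_nonneg (α := ℝ) n])
  simpa only [Real.rpow_natCast] using h

theorem cP_nonneg (p : ℕ) : 0 ≤ cP p :=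
  div_nonneg p.cast_nonneg (Real.Gamma_pos_of_pos (by positivity)).le

theorem one_sub_erfP_eq_integral_Ioi {p : ℕ} (hp : 1 ≤ p) {x : ℝ} (hx : 0 ≤ x) :
    1 - erfP p x = cP p * ∫ r in Set.Ioi x, r ^ (p - 1) * Real.exp (-1 * r ^ 2) := by
  have hi := integrableOn_pow_mul_exp_neg_mul_sq (p - 1) one_pos
  have h := cP_mul_integral_pow_mul_exp_neg_mul_sq hp one_pos
  rw [← intervalIntegral.integral_interval_add_Ioi hi (hi.mono_set (Set.Ioi_subset_Ioi hx)),
    Real.one_rpow, mul_add] at h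
  simp only [erfP, neg_one_mul] at h ⊢
  linarith

/-- A Chernoff-type bound for the tail of the generalized error function. -/
theorem one_sub_erfP_le {p : ℕ} (hp : 1 ≤ p) {x : ℝ} (hx : 0 ≤ x) :
    1 - erfP p x ≤ (2 : ℝ) ^ ((p : ℝ) / 2) * Real.exp (-x ^ 2 / 2) := by
  have hi := integrableOn_pow_mul_exp_neg_mul_sq (p - 1) one_pos
  have hi' := integrableOn_pow_mul_exp_neg_mul_sq (p - 1) (b := 1 / 2) (by norm_num)
  have hsub := Set.Ioi_subset_Ioi hx
  have key : ∫ r in Set.Ioi x, r ^ (p - 1) * Real.exp (-1 * r ^ 2) ≤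
      Real.exp (-x ^ 2 / 2) *
        ∫ r in Set.Ioi (0 : ℝ), r ^ (p - 1) * Real.exp (-(1 / 2) * r ^ 2) := by
    calc ∫ r in Set.Ioi x, r ^ (p - 1) * Real.exp (-1 * r ^ 2)
        ≤ ∫ r in Set.Ioi x,
            Real.exp (-x ^ 2 / 2) * (r ^ (p - 1) * Real.exp (-(1 / 2) * r ^ 2)) := by
          refine setIntegral_mono_on (hi.mono_set hsub) ((hi'.mono_set hsub).const_mul _)
            measurableSet_Ioi fun r hr ↦ ?_
          have hr : x < r := hr
          rw [mul_left_comm, ← Real.exp_add]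
          have : 0 ≤ r := hx.trans hr.le
          gcongr
          nlinarith
      _ = Real.exp (-x ^ 2 / 2) *
            ∫ r in Set.Ioi x, r ^ (p - 1) * Real.exp (-(1 / 2) * r ^ 2) :=
          integral_const_mul _ _
      _ ≤ _ := by
          refine mul_le_mul_of_nonneg_left (setIntegral_mono_set hi' ?_ hsub.eventuallyLE)
            (Real.exp_pos _).le
          refine (ae_restrict_mem measurableSet_Ioi).mono fun r (hr : 0 < r) ↦ ?_
          exact mul_nonneg (pow_nonneg hr.le _) (Real.exp_pos _).le
  calc 1 - erfP p x
      ≤ cP p * (Real.exp (-x ^ 2 / 2) *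
          ∫ r in Set.Ioi (0 : ℝ), r ^ (p - 1) * Real.exp (-(1 / 2) * r ^ 2)) := by
        rw [one_sub_erfP_eq_integral_Ioi hp hx]
        exact mul_le_mul_of_nonneg_left key (cP_nonneg p)
    _ = (2 : ℝ) ^ ((p : ℝ) / 2) * Real.exp (-x ^ 2 / 2) := by
        rw [mul_left_comm, cP_mul_integral_pow_mul_exp_neg_mul_sq hp (by norm_num), one_div,
          Real.inv_rpow two_pos.le, Real.rpow_neg two_pos.le, inv_inv, mul_comm]

theorem sqrt_one_sub_erfP_le (p : ℕ) (hp : 1 ≤ p) (x : ℝ) (hx : 0 ≤ x) :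
    Real.sqrt (1 - erfP p x) ≤ (2 : ℝ) ^ ((p : ℝ) / 4) * Real.exp (-x ^ 2 / 4) := by
  refine Real.sqrt_le_iff.mpr ⟨by positivity, (one_sub_erfP_le hp hx).trans_eq ?_⟩
  rw [mul_pow, ← Real.rpow_mul_natCast two_pos.le, ← Real.exp_nat_mul]
  congr 2 <;> push_cast <;> ring
end

section
/- For every even integer p ≥ 2, both the function x ↦ 1 − erf_p(|x|) and the function x ↦ √(1 − erf_p(|x|)) from ℝ to ℝ are Schwartz functions: they are infinitely differentiable and, for all natural numbers k and n, the function x ↦ x^k · g^{(n)}(x) is bounded on ℝ (g denoting either function). -/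
open MeasureTheory

open Polynomial in
/-- If `g' = (R / Q) g` with polynomials `R`, `Q`, then `g⁽ⁿ⁾ = (P / Qⁿ) g` for some
polynomial `P`. -/
theorem exists_iteratedDeriv_eq_polynomial_div_mul {Q R : ℝ[X]} {g : ℝ → ℝ}
    (hQ : ∀ x, 1 ≤ Q.eval x) (hg : ∀ x, HasDerivAt g (R.eval x / Q.eval x * g x) x) (n : ℕ) :
    ∃ P : ℝ[X], iteratedDeriv n g = fun x => P.eval x / Q.eval x ^ n * g x := by
  induction n with
  | zero => exact ⟨1, by ext x; simp⟩
  | succ n ih =>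
    obtain ⟨P, hP⟩ := ih
    refine ⟨derivative P * Q - C (n : ℝ) * P * derivative Q + P * R, ?_⟩
    ext x
    have hx : Q.eval x ≠ 0 := (zero_lt_one.trans_le (hQ x)).ne'
    rw [iteratedDeriv_succ, hP]
    refine (((P.hasDerivAt x).fun_div ((Q.hasDerivAt x).fun_pow n)
      (pow_ne_zero n hx)).fun_mul (hg x)).deriv.trans ?_
    simp only [eval_add, eval_sub, eval_mul, eval_C]
    rcases n with _ | n
    · simp
      field_simp
    · simp only [Nat.add_sub_cancel]
      field_simp
      ring

open Polynomial in
/-- A smooth function with `g' = (R / Q) g`, where `1 ≤ Q`, all of whose products with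
polynomials are bounded, is rapidly decreasing together with its derivatives. -/
theorem exists_abs_pow_mul_iteratedDeriv_le {Q R : ℝ[X]} {g : ℝ → ℝ}
    (hQ : ∀ x, 1 ≤ Q.eval x) (hg : ∀ x, HasDerivAt g (R.eval x / Q.eval x * g x) x)
    (hb : ∀ P : ℝ[X], ∃ C : ℝ, ∀ x, |P.eval x * g x| ≤ C) (k n : ℕ) :
    ∃ C : ℝ, ∀ x : ℝ, |x ^ k * iteratedDeriv n g x| ≤ C := by
  obtain ⟨P, hP⟩ := exists_iteratedDeriv_eq_polynomial_div_mul hQ hg n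
  obtain ⟨C, hC⟩ := hb (X ^ k * P)
  refine ⟨C, fun x => le_trans ?_ (hC x)⟩
  have h1 : 1 ≤ Q.eval x ^ n := one_le_pow₀ (hQ x)
  have h2 : x ^ k * iteratedDeriv n g x = (X ^ k * P).eval x * g x / Q.eval x ^ n := by
    simp only [hP, eval_mul, eval_pow, eval_X]
    ring
  rw [h2, abs_div, abs_of_pos (zero_lt_one.trans_le h1)]
  exact div_le_self (abs_nonneg _) h1

open Polynomial in
theorem exists_abs_polynomial_mul_exp_neg_sq_le (P : ℝ[X]) :
    ∃ C : ℝ, ∀ x : ℝ, |P.eval x * Real.exp (-x ^ 2)| ≤ C := by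
  induction P using Polynomial.induction_on' with
  | add p q hp hq =>
    obtain ⟨C, hC⟩ := hp
    obtain ⟨D, hD⟩ := hq
    refine ⟨C + D, fun x => ?_⟩
    rw [eval_add, add_mul]
    exact (abs_add_le _ _).trans (add_le_add (hC x) (hD x))
  | monomial k a =>
    refine ⟨|a| * (1 + k.factorial), fun x => ?_⟩
    rw [eval_monomial, mul_assoc, abs_mul, abs_mul, abs_pow, Real.abs_exp]
    have h1 : (x ^ 2) ^ k ≤ k.factorial * Real.exp (x ^ 2) := by
      have := Real.pow_div_factorial_le_exp (x ^ 2) (sq_nonneg x) k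
      rwa [div_le_iff₀' (by positivity)] at this
    have h2 : |x| ^ k ≤ 1 + (x ^ 2) ^ k := by
      rw [← sq_abs, ← pow_mul, mul_comm 2 k, pow_mul]
      nlinarith [sq_nonneg (|x| ^ k - 1)]
    have h3 : 1 ≤ Real.exp (x ^ 2) := Real.one_le_exp (sq_nonneg x)
    rw [Real.exp_neg, ← div_eq_mul_inv]
    gcongr
    rw [div_le_iff₀ (Real.exp_pos _)]
    linarith

open Polynomial in
/-- The truncated exponential series `∑_{j < m} X^{2j} / j!`. -/
noncomputable def truncatedExpSq (m : ℕ) : ℝ[X] :=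
  ∑ j ∈ Finset.range m, C ((j.factorial : ℝ)⁻¹) * X ^ (2 * j)

theorem eval_truncatedExpSq (m : ℕ) (x : ℝ) : (truncatedExpSq m).eval x =
    ∑ j ∈ Finset.range m, (j.factorial : ℝ)⁻¹ * x ^ (2 * j) := by
  simp [truncatedExpSq, Polynomial.eval_finsetSum]

theorem one_le_eval_truncatedExpSq_succ (m : ℕ) (x : ℝ) :
    1 ≤ (truncatedExpSq (m + 1)).eval x := by
  rw [eval_truncatedExpSq, Finset.sum_range_succ']
  have : 0 ≤ ∑ j ∈ Finset.range m, ((j + 1).factorial : ℝ)⁻¹ * x ^ (2 * (j + 1)) :=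
    Finset.sum_nonneg fun j _ => mul_nonneg (by positivity) ((even_two_mul _).pow_nonneg x)
  simpa using this

theorem hasDerivAt_exp_neg_sq (x : ℝ) :
    HasDerivAt (fun x : ℝ => Real.exp (-x ^ 2)) (-(2 * x) * Real.exp (-x ^ 2)) x := by
  refine (hasDerivAt_pow 2 x).fun_neg.exp.congr_deriv ?_
  push_cast
  ring

theorem eval_derivative_truncatedExpSq_succ (m : ℕ) (x : ℝ) :
    (truncatedExpSq (m + 1)).derivative.eval x =
      2 * x * (truncatedExpSq (m + 1)).eval x - 2 * x ^ (2 * m + 1) / m.factorial := by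
  induction m with
  | zero => simp [truncatedExpSq]
  | succ m ih =>
    have h : truncatedExpSq (m + 1 + 1) = truncatedExpSq (m + 1) +
        Polynomial.C (((m + 1).factorial : ℝ)⁻¹) * Polynomial.X ^ (2 * (m + 1)) :=
      Finset.sum_range_succ _ _
    have hm : (m.factorial : ℝ) ≠ 0 := by positivity
    have hm' : (m : ℝ) + 1 ≠ 0 := by positivity
    rw [h, Polynomial.derivative_add, Polynomial.eval_add, ih, Polynomial.eval_add,
      Polynomial.derivative_C_mul_X_pow, Nat.factorial_succ]
    simp only [Polynomial.eval_mul, Polynomial.eval_C, Polynomial.eval_pow, Polynomial.eval_X]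
    rw [show 2 * (m + 1) - 1 = 2 * m + 1 by omega]
    push_cast
    field_simp
    ring

theorem one_sub_erfP_two_mul_succ (m : ℕ) (x : ℝ) :
    1 - erfP (2 * (m + 1)) x = (truncatedExpSq (m + 1)).eval x * Real.exp (-x ^ 2) := by
  have hm : (m.factorial : ℝ) ≠ 0 := by positivity
  have hm' : (m : ℝ) + 1 ≠ 0 := by positivity
  have hc : cP (2 * (m + 1)) = 2 / m.factorial := by
    have h : ((2 * (m + 1) : ℕ) : ℝ) / 2 + 1 = ((m + 1 : ℕ) : ℝ) + 1 := by push_cast; ring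
    rw [cP, h, Real.Gamma_nat_eq_factorial, Nat.factorial_succ]
    push_cast
    field_simp
  have hd (y : ℝ) : HasDerivAt
      (fun y => -((truncatedExpSq (m + 1)).eval y * Real.exp (-y ^ 2)))
      (2 / m.factorial * (y ^ (2 * m + 1) * Real.exp (-y ^ 2))) y := by
    refine (((truncatedExpSq (m + 1)).hasDerivAt y).fun_mul
      (hasDerivAt_exp_neg_sq y)).fun_neg.congr_deriv ?_
    rw [eval_derivative_truncatedExpSq_succ]
    ring
  have h0 : (truncatedExpSq (m + 1)).eval 0 = 1 := by
    simp [eval_truncatedExpSq, Finset.sum_range_succ']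
  rw [erfP, hc, show 2 * (m + 1) - 1 = 2 * m + 1 by omega,
    ← intervalIntegral.integral_const_mul,
    intervalIntegral.integral_eq_sub_of_hasDerivAt (fun y _ => hd y)
      (Continuous.intervalIntegrable (by fun_prop) _ _), h0]
  simp

theorem one_sub_erfP_two_mul_succ_abs (m : ℕ) (x : ℝ) :
    1 - erfP (2 * (m + 1)) |x| = (truncatedExpSq (m + 1)).eval x * Real.exp (-x ^ 2) := by
  simp only [one_sub_erfP_two_mul_succ, eval_truncatedExpSq, pow_mul, sq_abs]

/-- For `p` even, both `x ↦ 1 − erf_p(|x|)` and `x ↦ √(1 − erf_p(|x|))` are Schwartz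
functions: infinitely differentiable, with `x^k · g⁽ⁿ⁾(x)` bounded on `ℝ` for all `k, n`. -/
theorem fP_and_sqrt_fP_schwartz_of_even (p : ℕ) (hp : 2 ≤ p) (hpe : Even p) :
    (ContDiff ℝ (⊤ : ℕ∞) (fun x : ℝ => 1 - erfP p |x|) ∧
      ∀ k n : ℕ, ∃ C : ℝ, ∀ x : ℝ,
        |x ^ k * iteratedDeriv n (fun x : ℝ => 1 - erfP p |x|) x| ≤ C) ∧
    (ContDiff ℝ (⊤ : ℕ∞) (fun x : ℝ => Real.sqrt (1 - erfP p |x|)) ∧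
      ∀ k n : ℕ, ∃ C : ℝ, ∀ x : ℝ,
        |x ^ k * iteratedDeriv n (fun x : ℝ => Real.sqrt (1 - erfP p |x|)) x| ≤ C) := by
  obtain ⟨m, rfl⟩ : ∃ m, p = 2 * (m + 1) := by
    obtain ⟨r, rfl⟩ := hpe
    exact ⟨r - 1, by omega⟩
  simp only [one_sub_erfP_two_mul_succ_abs]
  have hQ := one_le_eval_truncatedExpSq_succ m
  set Q := truncatedExpSq (m + 1)
  have hpos (x : ℝ) : 0 < Q.eval x * Real.exp (-x ^ 2) :=
    mul_pos (zero_lt_one.trans_le (hQ x)) (Real.exp_pos _)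
  have hsmooth : ContDiff ℝ (⊤ : ℕ∞) (fun x : ℝ => Q.eval x * Real.exp (-x ^ 2)) :=
    (by simpa using Q.contDiff_aeval (𝕜 := ℝ) _ : ContDiff ℝ _ fun x => Q.eval x).mul
      (by fun_prop)
  have hderiv (x : ℝ) : HasDerivAt (fun x : ℝ => Q.eval x * Real.exp (-x ^ 2))
      ((Q.derivative - 2 * Polynomial.X * Q).eval x / Q.eval x *
        (Q.eval x * Real.exp (-x ^ 2))) x := by
    refine ((Q.hasDerivAt x).fun_mul (hasDerivAt_exp_neg_sq x)).congr_deriv ?_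
    have := (zero_lt_one.trans_le (hQ x)).ne'
    simp only [Polynomial.eval_sub, Polynomial.eval_mul, Polynomial.eval_ofNat,
      Polynomial.eval_X]
    field_simp
    ring
  have hbound (P : Polynomial ℝ) :
      ∃ C : ℝ, ∀ x, |P.eval x * (Q.eval x * Real.exp (-x ^ 2))| ≤ C := by
    simpa only [Polynomial.eval_mul, mul_assoc] using
      exists_abs_polynomial_mul_exp_neg_sq_le (P * Q)
  refine ⟨⟨hsmooth, exists_abs_pow_mul_iteratedDeriv_le hQ hderiv hbound⟩,
    hsmooth.sqrt fun x => (hpos x).ne',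
    exists_abs_pow_mul_iteratedDeriv_le
      (R := Polynomial.C (1 / 2) * (Q.derivative - 2 * Polynomial.X * Q)) hQ
      (fun x => ?_) fun P => ?_⟩
  · refine ((hderiv x).sqrt (hpos x).ne').congr_deriv ?_
    rw [Polynomial.eval_mul, Polynomial.eval_C]
    have hs := (Real.sqrt_pos.2 (hpos x)).ne'
    rw [div_eq_iff (mul_ne_zero two_ne_zero hs)]
    linear_combination -((Q.derivative - 2 * Polynomial.X * Q).eval x / Q.eval x) *
      Real.mul_self_sqrt (hpos x).le
  · obtain ⟨C, hC⟩ := hbound (P ^ 2)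
    refine ⟨Real.sqrt C, fun x => Real.abs_le_sqrt ?_⟩
    rw [mul_pow, Real.sq_sqrt (hpos x).le, ← Polynomial.eval_pow]
    exact (le_abs_self _).trans (hC x)
end

section
/- Let 𝔄 be a unital C*-algebra, let D, a ∈ 𝔄 with D self-adjoint, and let h : ℝ → ℝ be a Schwartz function. Then ‖ h(D)·a − a·h(D) ‖ ≤ 2π · ‖Da − aD‖ · ∫_ℝ |ξ| · |𝓕h(ξ)| dξ, where h(D) denotes the continuous functional calculus of h applied to D, and 𝓕h(ξ) = ∫_ℝ h(x)·e^{−2πixξ} dx is the Fourier transform of h. -/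
open MeasureTheory FourierTransform SchwartzMap

open NormedSpace in
lemma NormedSpace.exp_smul_mem_unitary_of_isSelfAdjoint {𝔄 : Type*} [CStarAlgebra 𝔄] {D : 𝔄}
    (hD : IsSelfAdjoint D) (t : ℝ) : exp (t • (Complex.I • D)) ∈ unitary 𝔄 := by
  have h := (selfAdjoint.expUnitary (⟨t • D, (IsSelfAdjoint.all t).smul hD⟩ : selfAdjoint 𝔄)).2
  rwa [selfAdjoint.expUnitary_coe, smul_comm] at h

open NormedSpace in
/-- The commutator of an element with the one-parameter unitary group generated by a self-adjoint
element `D` grows at most linearly, with slope the norm of the commutator with `D`. -/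
lemma norm_commutator_exp_smul_le {𝔄 : Type*} [CStarAlgebra 𝔄] {D : 𝔄} (hD : IsSelfAdjoint D)
    (a : 𝔄) (t : ℝ) :
    ‖exp (t • (Complex.I • D)) * a - a * exp (t • (Complex.I • D))‖ ≤ |t| * ‖D * a - a * D‖ := by
  set X : 𝔄 := Complex.I • D with hX
  have hU (s : ℝ) : exp (s • X) ∈ unitary 𝔄 := exp_smul_mem_unitary_of_isSelfAdjoint hD s
  have hV (s : ℝ) : exp (s • -X) ∈ unitary 𝔄 := by
    simpa using hU (-s)
  have hinv : exp (t • -X) * exp (t • X) = 1 := by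
    let +nondep : NormedAlgebra ℚ 𝔄 := .restrictScalars ℚ ℂ 𝔄
    rw [← exp_add_of_commute (((Commute.refl X).neg_left.smul_left t).smul_right t)]
    simp
  have hinv' : exp (t • X) * exp (t • -X) = 1 := by
    let +nondep : NormedAlgebra ℚ 𝔄 := .restrictScalars ℚ ℂ 𝔄
    rw [← exp_add_of_commute (((Commute.refl X).neg_right.smul_left t).smul_right t)]
    simp
  have hderiv (s : ℝ) : HasDerivAt (fun s : ℝ => exp (s • X) * a * exp (s • -X))
      (exp (s • X) * (X * a - a * X) * exp (s • -X)) s := by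
    convert! ((hasDerivAt_exp_smul_const X s).mul_const a).mul
      (hasDerivAt_exp_smul_const' (-X) s) using 1
    noncomm_ring
  have hnorm (s : ℝ) :
      ‖exp (s • X) * (X * a - a * X) * exp (s • -X)‖ ≤ ‖D * a - a * D‖ := by
    rw [CStarRing.norm_mul_mem_unitary _ (hV s), CStarRing.norm_mem_unitary_mul _ (hU s), hX,
      smul_mul_assoc, mul_smul_comm, ← smul_sub, norm_smul, Complex.norm_I, one_mul]
  have key := convex_univ.norm_image_sub_le_of_norm_hasDerivWithin_le
    (fun s _ => (hderiv s).hasDerivWithinAt) (fun s _ => hnorm s)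
    (Set.mem_univ 0) (Set.mem_univ t)
  have hfac : exp (t • X) * a * exp (t • -X) - exp ((0 : ℝ) • X) * a * exp ((0 : ℝ) • -X)
      = (exp (t • X) * a - a * exp (t • X)) * exp (t • -X) := by
    rw [sub_mul, mul_assoc a, hinv']
    simp
  rw [hfac, CStarRing.norm_mul_mem_unitary _ (hV t), sub_zero, Real.norm_eq_abs] at key
  rwa [mul_comm]

open NormedSpace in
lemma cfc_exp_ofReal_mul_re_mul_I {𝔄 : Type*} [CStarAlgebra 𝔄] {D : 𝔄} (hD : IsSelfAdjoint D)
    (t : ℝ) (c : ℂ) :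
    cfc (fun z : ℂ => Complex.exp ((t * z.re : ℝ) * Complex.I) * c) D
      = c • exp (t • (Complex.I • D)) := by
  have hcongr : cfc (fun z : ℂ => Complex.exp ((t * z.re : ℝ) * Complex.I) * c) D
      = cfc (fun z : ℂ => c * Complex.exp ((t * Complex.I) * z)) D := by
    refine cfc_congr fun z hz => ?_
    have hz' : z = (z.re : ℂ) := hD.mem_spectrum_eq_re hz
    rw [mul_comm c]
    conv_rhs => rw [hz']
    push_cast
    ring_nf
  have hexp : cfc (fun z : ℂ => Complex.exp ((t * Complex.I) * z)) D
      = exp ((t * Complex.I) • D) := by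
    have hN : IsStarNormal ((t * Complex.I) • D) := by
      have := hD.isStarNormal
      infer_instance
    rw [cfc_comp_const_mul (t * Complex.I) Complex.exp D,
      CFC.complex_exp_eq_normedSpace_exp hN]
  rw [hcongr, cfc_const_mul c _ D, hexp, mul_smul, Complex.coe_smul]

/-- Commutator estimate for functional calculus of a Schwartz function in a unital
C*-algebra: `‖[h(D), a]‖ ≤ 2π ‖[D,a]‖ ∫ |ξ| |𝓕h(ξ)| dξ`. -/
theorem norm_commutator_cfc_le
    (𝔄 : Type*) [CStarAlgebra 𝔄]
    (D a : 𝔄) (hD : IsSelfAdjoint D) (h : SchwartzMap ℝ ℝ) :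
    ‖cfc (fun x : ℝ => h x) D * a - a * cfc (fun x : ℝ => h x) D‖
      ≤ 2 * Real.pi * ‖D * a - a * D‖ *
          ∫ ξ : ℝ, |ξ| * ‖𝓕 (fun x : ℝ => (h x : ℂ)) ξ‖ := by
  have hN := hD.isStarNormal
  let H : 𝓢(ℝ, ℂ) := postcompCLM Complex.ofRealCLM h
  let G : 𝓢(ℝ, ℂ) := 𝓕 H
  have hG : 𝓕 (fun x : ℝ => (h x : ℂ)) = G := rfl
  have hinv (x : ℝ) :
      (h x : ℂ) = ∫ ξ : ℝ, Complex.exp ((2 * Real.pi * ξ * x : ℝ) * Complex.I) * G ξ := by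
    have h1 : 𝓕⁻ G = H := fourierInv_fourier_eq H
    have h2 : 𝓕⁻ (G : ℝ → ℂ) x = H x := by rw [← fourierInv_coe, h1]
    rw [Real.fourierInv_eq'] at h2
    refine h2.symm.trans (integral_congr_ae (.of_forall fun ξ => ?_))
    simp only [RCLike.inner_apply, conj_trivial, smul_eq_mul]
    ring_nf
  let f : ℝ → ℂ → ℂ := fun ξ z =>
    Complex.exp ((2 * Real.pi * ξ * z.re : ℝ) * Complex.I) * G ξ
  have hf : Continuous (Function.uncurry f) := by
    have := G.continuous
    simp only [f, Function.uncurry_def]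
    fun_prop
  have hbound : ∀ᵐ ξ : ℝ, ∀ z ∈ spectrum ℂ D, ‖f ξ z‖ ≤ ‖G ξ‖ :=
    .of_forall fun ξ z _ => by
      rw [norm_mul, Complex.norm_exp_ofReal_mul_I, one_mul]
  have hfin : HasFiniteIntegral (fun ξ => ‖G ξ‖) := G.integrable.norm.hasFiniteIntegral
  have hint : Integrable fun ξ => cfc (f ξ) D :=
    integrable_cfc f _ D hf.continuousOn hbound hfin
  have hcfc : cfc (fun x : ℝ => h x) D = ∫ ξ, cfc (f ξ) D := by
    rw [cfc_real_eq_complex, ← cfc_integral f _ D hf.continuousOn hbound hfin]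
    exact cfc_congr fun z _ => hinv z.re
  rw [hcfc, hG, ← integral_mul_const_of_integrable hint, ← integral_const_mul_of_integrable hint,
    ← integral_sub (hint.mul_const a) (hint.const_mul a), ← integral_const_mul]
  have hG1 : Integrable fun ξ : ℝ => |ξ| * ‖G ξ‖ := by
    simpa using G.integrable_pow_mul volume 1
  refine norm_integral_le_of_norm_le (hG1.const_mul _) (.of_forall fun ξ => ?_)
  rw [cfc_exp_ofReal_mul_re_mul_I hD, smul_mul_assoc, mul_smul_comm, ← smul_sub, norm_smul]
  calc _ ≤ ‖G ξ‖ * (|2 * Real.pi * ξ| * ‖D * a - a * D‖) := by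
        gcongr
        exact norm_commutator_exp_smul_le hD a _
    _ = _ := by
        rw [abs_mul, abs_of_pos Real.two_pi_pos]
        ring
end

section
/- Let 𝔄 be a unital C*-algebra, let D, a ∈ 𝔄 with D self-adjoint, and let h : ℝ → ℝ be a Schwartz function with derivative h′. Then ‖ [h(D), a] − (1/2)·( h′(D)·[D,a] + [D,a]·h′(D) ) ‖ ≤ 2π² · ‖[D,[D,a]]‖ · ∫_ℝ ξ² · |𝓕h(ξ)| dξ, where [x,y] = xy − yx, h(D) and h′(D) denote the continuous functional calculus of h and h′ applied to D, and 𝓕h(ξ) = ∫_ℝ h(x)·e^{−2πixξ} dx. -/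
open MeasureTheory FourierTransform SchwartzMap

section

variable {𝔄 : Type*} [CStarAlgebra 𝔄]

lemma exp_smul_mem_unitary_of_star_eq_neg {X : 𝔄} (hX : star X = -X) (t : ℝ) :
    NormedSpace.exp (t • X) ∈ unitary 𝔄 := by
  let +nondep : NormedAlgebra ℚ 𝔄 := .restrictScalars ℚ ℂ 𝔄
  exact NormedSpace.exp_mem_unitary_of_mem_skewAdjoint
    (skewAdjoint.smul_mem t (skewAdjoint.mem_iff.2 hX))

lemma hasDerivAt_exp_smul_conj (X b : 𝔄) (t : ℝ) :
    HasDerivAt (fun s : ℝ => NormedSpace.exp (s • X) * b * NormedSpace.exp (s • -X))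
      (NormedSpace.exp (t • X) * (X * b - b * X) * NormedSpace.exp (t • -X)) t := by
  refine (((hasDerivAt_exp_smul_const X t).mul_const b).mul
    (hasDerivAt_exp_smul_const' (-X) t)).congr_deriv ?_
  simp only [mul_sub, sub_mul, mul_assoc, neg_mul, mul_neg, ← sub_eq_add_neg]

lemma norm_exp_smul_conj {X : 𝔄} (hX : star X = -X) (b : 𝔄) (t : ℝ) :
    ‖NormedSpace.exp (t • X) * b * NormedSpace.exp (t • -X)‖ = ‖b‖ := by
  have hX' : star (-X) = - -X := by rw [star_neg, hX]
  rw [CStarRing.norm_mul_mem_unitary _ (exp_smul_mem_unitary_of_star_eq_neg hX' t),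
    CStarRing.norm_mem_unitary_mul _ (exp_smul_mem_unitary_of_star_eq_neg hX t)]

lemma norm_exp_smul_conj_sub_le {X : 𝔄} (hX : star X = -X) (b : 𝔄) {t : ℝ} (ht : 0 ≤ t) :
    ‖NormedSpace.exp (t • X) * b * NormedSpace.exp (t • -X) - b‖ ≤ t * ‖X * b - b * X‖ := by
  have hd (s : ℝ) := (hasDerivAt_exp_smul_conj X b s).sub_const b
  refine image_norm_le_of_norm_deriv_right_le_deriv_boundary (a := 0) (b := t)
    (fun s _ => (hd s).continuousAt.continuousWithinAt)
    (fun s _ => (hd s).hasDerivWithinAt) (B := fun s => s * ‖X * b - b * X‖)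
    (B' := fun _ => ‖X * b - b * X‖) (by simp)
    (fun s => by simpa using (hasDerivAt_id s).mul_const ‖X * b - b * X‖)
    (fun s _ => (norm_exp_smul_conj hX _ s).le) (Set.right_mem_Icc.2 ht)

lemma norm_exp_smul_conj_sub_trapezoid_le {X : 𝔄} (hX : star X = -X) (a : 𝔄) {t : ℝ}
    (ht : 0 ≤ t) :
    ‖NormedSpace.exp (t • X) * a * NormedSpace.exp (t • -X) - a - (t / 2) •
        (NormedSpace.exp (t • X) * (X * a - a * X) * NormedSpace.exp (t • -X)
          + (X * a - a * X))‖
      ≤ t ^ 2 / 2 * ‖X * (X * a - a * X) - (X * a - a * X) * X‖ := by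
  set b := X * a - a * X with hb
  set c := X * b - b * X with hc
  have hd (s : ℝ) := ((hasDerivAt_exp_smul_conj X a s).sub_const a).sub
    (((hasDerivAt_id s).div_const 2).smul ((hasDerivAt_exp_smul_conj X b s).add_const b))
  refine image_norm_le_of_norm_deriv_right_le_deriv_boundary (a := 0) (b := t)
    (fun s _ => (hd s).continuousAt.continuousWithinAt)
    (fun s _ => (hd s).hasDerivWithinAt) (B := fun s => s ^ 2 / 2 * ‖c‖)
    (B' := fun s => s * ‖c‖) (by simp)
    (fun s => ?_) (fun s hs => ?_) (Set.right_mem_Icc.2 ht)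
  · refine (((hasDerivAt_pow 2 s).div_const 2).mul_const ‖c‖).congr_deriv ?_
    ring
  · have h1 := norm_exp_smul_conj_sub_le hX b hs.1
    have h2 := norm_exp_smul_conj hX c s
    rw [← hb, ← hc] at *
    set P := NormedSpace.exp (s • X) * b * NormedSpace.exp (s • -X)
    set Q := NormedSpace.exp (s • X) * c * NormedSpace.exp (s • -X)
    have : P - ((id s / 2) • Q + ((1 : ℝ) / 2) • (P + b))
        = ((1 : ℝ) / 2) • (P - b) - (s / 2) • Q := by
      simp only [id]; module
    rw [this]
    refine (norm_sub_le _ _).trans ?_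
    rw [norm_smul, norm_smul, h2, Real.norm_of_nonneg (by norm_num),
      Real.norm_of_nonneg (by linarith [hs.1])]
    linarith

/-- Trapezoidal estimate for the commutator with a one-parameter unitary group. -/
lemma norm_commutator_exp_smul_sub_le {X : 𝔄} (hX : star X = -X) (a : 𝔄) (t : ℝ) :
    ‖(NormedSpace.exp (t • X) * a - a * NormedSpace.exp (t • X)) - (t / 2) •
        (NormedSpace.exp (t • X) * (X * a - a * X)
          + (X * a - a * X) * NormedSpace.exp (t • X))‖
      ≤ t ^ 2 / 2 * ‖X * (X * a - a * X) - (X * a - a * X) * X‖ := by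
  wlog ht : 0 ≤ t generalizing X t
  · convert this (X := -X) (by rw [star_neg, hX]) (-t) (by linarith) using 1
    · rw [smul_neg, neg_smul, neg_neg]
      congr 2
      rw [neg_div, neg_smul, ← smul_neg]
      congr 1
      noncomm_ring
    · rw [neg_sq]
      congr 2
      noncomm_ring
  have hu := exp_smul_mem_unitary_of_star_eq_neg hX t
  have hinv : NormedSpace.exp (t • -X) * NormedSpace.exp (t • X) = 1 := by
    let +nondep : NormedAlgebra ℚ 𝔄 := .restrictScalars ℚ ℂ 𝔄
    rw [← NormedSpace.exp_add_of_commute (((Commute.refl X).neg_left.smul_left t).smul_right t)]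
    simp
  refine le_trans (le_of_eq ?_) (norm_exp_smul_conj_sub_trapezoid_le hX a ht)
  rw [← CStarRing.norm_mul_mem_unitary (_ - _ - _ • (_ * _ * NormedSpace.exp (t • -X) + _)) hu]
  simp only [sub_mul, add_mul, smul_mul_assoc, mul_assoc, hinv, mul_one]

/-- Fourier inversion for the functional calculus of a self-adjoint element. -/
lemma cfc_ofReal_comp_eq_integral_fourier {D : 𝔄} (hD : IsSelfAdjoint D) (g : 𝓢(ℝ, ℂ)) :
    cfc (fun z : ℂ => g z.re) D
      = ∫ ξ : ℝ, 𝓕 (g : ℝ → ℂ) ξ • NormedSpace.exp ((2 * Real.pi * ξ) • (Complex.I • D)) := by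
  have hinv (x : ℝ) : g x = ∫ ξ : ℝ, 𝓕 (g : ℝ → ℂ) ξ *
      Complex.exp (2 * Real.pi * ξ * Complex.I * x) := by
    have : 𝓕⁻ (𝓕 (g : ℝ → ℂ)) x = g x := by
      rw [← SchwartzMap.fourier_coe, ← SchwartzMap.fourierInv_coe, fourierInv_fourier_eq]
    rw [← this, Real.fourierInv_eq']
    congr 1; ext ξ
    rw [smul_eq_mul, mul_comm]
    simp only [RCLike.inner_apply, conj_trivial]
    congr 2; push_cast; ring
  have hcfc (ξ : ℝ) : cfc (fun z : ℂ => 𝓕 (g : ℝ → ℂ) ξ *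
      Complex.exp (2 * Real.pi * ξ * Complex.I * z)) D
        = 𝓕 (g : ℝ → ℂ) ξ • NormedSpace.exp ((2 * Real.pi * ξ) • (Complex.I • D)) := by
    have hD' := hD.isStarNormal
    rw [cfc_const_mul _ _ _ (by fun_prop), cfc_comp_const_mul _ Complex.exp _ (by fun_prop),
      CFC.complex_exp_eq_normedSpace_exp (hD'.smul _), ← Complex.coe_smul, smul_smul]
    norm_cast
  simp_rw [← hcfc]
  rw [← cfc_integral (𝕜 := ℂ) _ (fun ξ => ‖𝓕 (g : ℝ → ℂ) ξ‖) D]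
  · refine cfc_congr fun z hz => ?_
    have : z = (z.re : ℂ) := hD.mem_spectrum_eq_re hz
    rw [this]
    simpa using hinv z.re
  · have : Continuous (𝓕 (g : ℝ → ℂ)) := by
      rw [← SchwartzMap.fourier_coe]; exact SchwartzMap.continuous _
    apply Continuous.continuousOn
    simp only [Function.uncurry_def]
    fun_prop
  · refine .of_forall fun ξ z hz => ?_
    have : z = (z.re : ℂ) := hD.mem_spectrum_eq_re hz
    rw [this, norm_mul, Complex.norm_exp]
    simp
  · have : Integrable (𝓕 (g : ℝ → ℂ)) := by
      rw [← SchwartzMap.fourier_coe]; exact SchwartzMap.integrable _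
    exact this.norm.2

lemma integrable_fourier_smul_exp_smul {X : 𝔄} (hX : star X = -X) (g : 𝓢(ℝ, ℂ)) :
    Integrable fun ξ : ℝ => 𝓕 (g : ℝ → ℂ) ξ • NormedSpace.exp ((2 * Real.pi * ξ) • X) := by
  have hg : Integrable (𝓕 (g : ℝ → ℂ)) := by
    rw [← SchwartzMap.fourier_coe]; exact SchwartzMap.integrable _
  have hE : Continuous fun ξ : ℝ => NormedSpace.exp ((2 * Real.pi * ξ) • X) := by
    let +nondep : NormedAlgebra ℚ 𝔄 := .restrictScalars ℚ ℂ 𝔄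
    exact NormedSpace.exp_continuous.comp (by fun_prop)
  refine hg.smul_bdd ‖(1 : 𝔄)‖ hE.aestronglyMeasurable (.of_forall fun ξ => ?_)
  rw [← mul_one (NormedSpace.exp _),
    CStarRing.norm_mem_unitary_mul _ (exp_smul_mem_unitary_of_star_eq_neg hX _)]

end

/-- Approximate chain rule for commutators, in operator norm: for `D` self-adjoint in a
unital C*-algebra and `h` a Schwartz function,
`‖[h(D), a] − ½(h′(D)[D,a] + [D,a]h′(D))‖ ≤ 2π² ‖[D,[D,a]]‖ ∫ ξ² |𝓕h(ξ)| dξ`. -/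
theorem norm_commutator_cfc_sub_anticommutator_le
    (𝔄 : Type*) [CStarAlgebra 𝔄]
    (D a : 𝔄) (hD : IsSelfAdjoint D) (h : SchwartzMap ℝ ℝ) :
    ‖(cfc (fun x : ℝ => h x) D * a - a * cfc (fun x : ℝ => h x) D)
        - (1 / 2 : ℝ) • (cfc (fun x : ℝ => deriv h x) D * (D * a - a * D)
            + (D * a - a * D) * cfc (fun x : ℝ => deriv h x) D)‖
      ≤ 2 * Real.pi ^ 2 * ‖D * (D * a - a * D) - (D * a - a * D) * D‖ *
          ∫ ξ : ℝ, ξ ^ 2 * ‖𝓕 (fun x : ℝ => (h x : ℂ)) ξ‖ := by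
  set X : 𝔄 := Complex.I • D with hXdef
  have hX : star X = -X := by simp [hXdef, star_smul, hD.star_eq]
  let g : 𝓢(ℝ, ℂ) := h.postcompCLM Complex.ofRealCLM
  have hg : (g : ℝ → ℂ) = fun x : ℝ => (h x : ℂ) := rfl
  have hdg (x : ℝ) : deriv g x = ((deriv h x : ℝ) : ℂ) :=
    HasDerivAt.deriv (f := fun y => (h y : ℂ)) (h.hasDerivAt x).ofReal_comp
  let g' : 𝓢(ℝ, ℂ) := SchwartzMap.derivCLM ℂ ℂ g
  have hg' : (g' : ℝ → ℂ) = deriv g := rfl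
  have hFg' (ξ : ℝ) : 𝓕 (g' : ℝ → ℂ) ξ = (2 * Real.pi * Complex.I * ξ) * 𝓕 (g : ℝ → ℂ) ξ := by
    rw [hg', Real.fourier_deriv g.integrable g.differentiable g'.integrable]
    rfl
  set E : ℝ → 𝔄 := fun ξ => NormedSpace.exp ((2 * Real.pi * ξ) • X)
  have hcfc : cfc (fun x : ℝ => h x) D = ∫ ξ : ℝ, 𝓕 (g : ℝ → ℂ) ξ • E ξ := by
    rw [cfc_real_eq_complex _ hD]
    exact cfc_ofReal_comp_eq_integral_fourier hD g
  have hcfc' : cfc (fun x : ℝ => deriv h x) D = ∫ ξ : ℝ, 𝓕 (g' : ℝ → ℂ) ξ • E ξ := by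
    rw [cfc_real_eq_complex _ hD]
    simp_rw [← hdg]
    exact cfc_ofReal_comp_eq_integral_fourier hD g'
  have hi : Integrable fun ξ : ℝ => 𝓕 (g : ℝ → ℂ) ξ • E ξ :=
    integrable_fourier_smul_exp_smul hX g
  have hi' : Integrable fun ξ : ℝ => 𝓕 (g' : ℝ → ℂ) ξ • E ξ :=
    integrable_fourier_smul_exp_smul hX g'
  have hcomm : Integrable fun ξ : ℝ =>
      𝓕 (g : ℝ → ℂ) ξ • E ξ * a - a * 𝓕 (g : ℝ → ℂ) ξ • E ξ :=
    (hi.mul_const _).sub (hi.const_mul _)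
  have hanti : Integrable fun ξ : ℝ => (1 / 2 : ℝ) •
      (𝓕 (g' : ℝ → ℂ) ξ • E ξ * (D * a - a * D)
        + (D * a - a * D) * 𝓕 (g' : ℝ → ℂ) ξ • E ξ) :=
    ((hi'.mul_const _).add (hi'.const_mul _)).smul (1 / 2 : ℝ)
  rw [← hg, hcfc, hcfc', ← integral_mul_const_of_integrable hi,
    ← integral_const_mul_of_integrable hi, ← integral_mul_const_of_integrable hi',
    ← integral_const_mul_of_integrable hi',
    ← integral_sub (hi.mul_const _) (hi.const_mul _),
    ← integral_add (hi'.mul_const _) (hi'.const_mul _), ← integral_smul,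
    ← integral_sub hcomm hanti, ← integral_const_mul]
  have hint : Integrable fun ξ : ℝ => ξ ^ 2 * ‖𝓕 (g : ℝ → ℂ) ξ‖ := by
    refine ((𝓕 g).integrable_pow_mul volume 2).congr (.of_forall fun ξ => ?_)
    simp only [SchwartzMap.fourier_coe, Real.norm_eq_abs, sq_abs]
  refine norm_integral_le_of_norm_le (hint.const_mul _) (.of_forall fun ξ => ?_)
  have hkey := norm_commutator_exp_smul_sub_le hX a (2 * Real.pi * ξ)
  have hB : X * a - a * X = Complex.I • (D * a - a * D) := by
    simp [hXdef, smul_sub]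
  have hC : X * (X * a - a * X) - (X * a - a * X) * X
      = -(D * (D * a - a * D) - (D * a - a * D) * D) := by
    rw [hB, hXdef, smul_mul_smul_comm, smul_mul_smul_comm, ← smul_sub, Complex.I_mul_I,
      neg_one_smul]
  rw [hC, norm_neg, hB] at hkey
  have heq : 𝓕 (g : ℝ → ℂ) ξ • E ξ * a - a * 𝓕 (g : ℝ → ℂ) ξ • E ξ
      - (1 / 2 : ℝ) • (𝓕 (g' : ℝ → ℂ) ξ • E ξ * (D * a - a * D)
        + (D * a - a * D) * 𝓕 (g' : ℝ → ℂ) ξ • E ξ)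
      = 𝓕 (g : ℝ → ℂ) ξ • ((E ξ * a - a * E ξ) - (2 * Real.pi * ξ / 2) •
        (E ξ * Complex.I • (D * a - a * D) + Complex.I • (D * a - a * D) * E ξ)) := by
    rw [hFg']
    simp only [smul_mul_assoc, mul_smul_comm, ← Complex.coe_smul]
    push_cast
    module
  rw [heq, norm_smul]
  refine (mul_le_mul_of_nonneg_left hkey (norm_nonneg _)).trans_eq ?_
  ring
end

section
/- Let 𝔄 be a unital C*-algebra, let D ∈ 𝔄 be self-adjoint and invertible, set |D| = (D²)^{1/2} (the positive square root via continuous functional calculus, which is invertible) and F = D·|D|^{−1}. Then for every a ∈ 𝔄 with a* = −a, the commutator [F,a] = Fa − aF is self-adjoint and satisfies the operator inequalities −‖Da − aD‖ · |D|^{−1} ≤ [F,a] ≤ ‖Da − aD‖ · |D|^{−1} in the canonical partial order on self-adjoint elements of 𝔄. -/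
open MeasureTheory

/-- An element of a C⋆-algebra whose real part is bounded below by a positive scalar satisfies
`δ ^ 2 ≤ star m * m`. -/
lemma sq_smul_one_le_star_mul_self {A : Type*} [CStarAlgebra A] [PartialOrder A]
    [StarOrderedRing A] {m : A} {δ : ℝ} (hδ : 0 ≤ δ) (h : (2 * δ) • (1 : A) ≤ m + star m) :
    δ ^ 2 • (1 : A) ≤ star m * m := by
  have h₁ : 0 ≤ star (m - δ • 1) * (m - δ • 1) := star_mul_self_nonneg _
  have h₂ : 0 ≤ δ • (m + star m - (2 * δ) • (1 : A)) := smul_nonneg hδ (sub_nonneg.2 h)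
  rw [← sub_nonneg]
  convert add_nonneg h₁ h₂ using 1
  simp only [star_sub, star_smul, star_one, star_trivial, mul_sub, sub_mul, smul_mul_assoc,
    mul_smul_comm, one_mul, mul_one, smul_sub, smul_add]
  module

/-- A strictly accretive element of a C⋆-algebra is invertible. -/
lemma isUnit_of_smul_one_le_add_star {A : Type*} [CStarAlgebra A] [PartialOrder A]
    [StarOrderedRing A] {m : A} {δ : ℝ} (hδ : 0 < δ) (h : (2 * δ) • (1 : A) ≤ m + star m) :
    IsUnit m := by
  have hpos : IsStrictlyPositive (δ ^ 2 • (1 : A)) := isStrictlyPositive_one.smul (by positivity)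
  have h₁ : IsUnit (star m * m) :=
    CStarAlgebra.isUnit_of_le _ (sq_smul_one_le_star_mul_self hδ.le h) hpos
  have h₂ : IsUnit (m * star m) := by
    have := sq_smul_one_le_star_mul_self (m := star m) hδ.le (by rwa [star_star, add_comm])
    rw [star_star] at this
    exact CStarAlgebra.isUnit_of_le _ this hpos
  obtain ⟨x, hx⟩ := h₁.exists_left_inv
  obtain ⟨y, hy⟩ := h₂.exists_right_inv
  exact isUnit_iff_exists_and_exists.2 ⟨⟨star m * y, by rw [← mul_assoc, hy]⟩,
    ⟨x * star m, by rw [mul_assoc, hx]⟩⟩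

/-- If `p` is strictly positive and the Jordan product of `p` with a self-adjoint `z` is
nonnegative, then `z` is nonnegative. -/
lemma nonneg_of_mul_add_mul_nonneg {A : Type*} [CStarAlgebra A] [PartialOrder A]
    [StarOrderedRing A] {p z : A} (hp : IsStrictlyPositive p) (hz : IsSelfAdjoint z)
    (h : 0 ≤ p * z + z * p) : 0 ≤ z := by
  obtain ⟨s, hs⟩ := hp.sqrt.isUnit
  have hs_sa : IsSelfAdjoint (s : A) := hs ▸ hp.sqrt.isSelfAdjoint
  have hsp : (s : A) * s = p := hs ▸ CFC.sqrt_mul_sqrt_self p hp.nonneg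
  have hw_sa : IsSelfAdjoint (s * z * s : A) := by
    simpa [hs_sa.star_eq] using hz.conjugate (s : A)
  have hw : (0 : A) ≤ s * z * s := by
    rw [StarOrderedRing.nonneg_iff_spectrum_nonneg (R := ℝ) _ hw_sa]
    intro r hr
    by_contra! hr0
    rw [← spectrum.units_conjugate (u := s)] at hr
    rw [spectrum.mem_iff, ← IsUnit.neg_iff] at hr
    refine hr ?_
    refine isUnit_of_smul_one_le_add_star (neg_pos.2 hr0) ?_
    have hconj : (s : A) * (s * z * s) * (s⁻¹ : Aˣ) = p * z := by
      rw [← hsp]; simp [mul_assoc]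
    rw [hconj, ← sub_nonneg]
    convert h using 1
    simp only [Algebra.algebraMap_eq_smul_one, star_neg, star_sub, star_mul, star_smul, star_one,
      star_trivial, hz.star_eq, hp.isSelfAdjoint.star_eq]
    module
  have hsi : IsSelfAdjoint ((s⁻¹ : Aˣ) : A) := by
    rw [IsSelfAdjoint, ← Units.coe_star, star_inv, show star s = s from Units.ext hs_sa.star_eq]
  have := hsi.conjugate_nonneg hw
  simpa [mul_assoc] using this

/-- The absolute value of an invertible element is strictly positive. -/
lemma IsUnit.isStrictlyPositive_abs {A : Type*} [CStarAlgebra A] [PartialOrder A]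
    [StarOrderedRing A] {d : A} (hu : IsUnit d) :
    IsStrictlyPositive (CFC.abs d) := by
  refine IsUnit.isStrictlyPositive ?_ (CFC.abs_nonneg d)
  exact (CFC.isUnit_sqrt_iff _ (star_mul_self_nonneg d)).2 (hu.star.mul hu)

/-- The square root of `d ^ 2` computed by the real functional calculus is `CFC.abs d`. -/
lemma IsSelfAdjoint.cfc_sqrt_sq_eq_abs {A : Type*} [CStarAlgebra A] [PartialOrder A]
    [StarOrderedRing A] {d : A} (hd : IsSelfAdjoint d) :
    cfc (fun t : ℝ => Real.sqrt t) (d ^ 2) = CFC.abs d := by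
  rw [CFC.abs, hd.star_eq, ← sq, CFC.sqrt_eq_real_sqrt _ hd.sq_nonneg, cfcₙ_eq_cfc]

/-- Key operator inequality of Lemma 5 of the paper: for `D` self-adjoint and invertible in
a unital C*-algebra, `|D| = (D²)^{1/2}`, `F = D|D|⁻¹`, and `a` skew-adjoint, the commutator
`[F,a]` is self-adjoint and satisfies `−‖[D,a]‖·|D|⁻¹ ≤ [F,a] ≤ ‖[D,a]‖·|D|⁻¹`. -/
theorem commutator_sign_le
    (𝔄 : Type*) [CStarAlgebra 𝔄] [PartialOrder 𝔄] [StarOrderedRing 𝔄]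
    (D : 𝔄) (hD : IsSelfAdjoint D) (hDinv : IsUnit D)
    (a : 𝔄) (ha : star a = -a) :
    IsSelfAdjoint
        (D * Ring.inverse (cfc (fun t : ℝ => Real.sqrt t) (D ^ 2)) * a
          - a * (D * Ring.inverse (cfc (fun t : ℝ => Real.sqrt t) (D ^ 2)))) ∧
      -(‖D * a - a * D‖ • Ring.inverse (cfc (fun t : ℝ => Real.sqrt t) (D ^ 2)))
          ≤ D * Ring.inverse (cfc (fun t : ℝ => Real.sqrt t) (D ^ 2)) * a
            - a * (D * Ring.inverse (cfc (fun t : ℝ => Real.sqrt t) (D ^ 2))) ∧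
        D * Ring.inverse (cfc (fun t : ℝ => Real.sqrt t) (D ^ 2)) * a
            - a * (D * Ring.inverse (cfc (fun t : ℝ => Real.sqrt t) (D ^ 2)))
          ≤ ‖D * a - a * D‖ • Ring.inverse (cfc (fun t : ℝ => Real.sqrt t) (D ^ 2)) := by
  rw [hD.cfc_sqrt_sq_eq_abs]
  have hp := hDinv.isStrictlyPositive_abs
  have hpD : Commute (CFC.abs D) D := CFC.commute_abs_self D
  have hpp : CFC.abs D * CFC.abs D = D * D := by rw [CFC.abs_mul_abs, hD.star_eq]
  set p := CFC.abs D
  obtain ⟨u, hu⟩ := hp.isUnit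
  rw [← hu, Ring.inverse_unit]
  rw [← hu] at hp hpD hpp
  set q : 𝔄 := ((u⁻¹ : 𝔄ˣ) : 𝔄) with hq
  have hpq : (u : 𝔄) * q = 1 := u.mul_inv
  have hqp : q * (u : 𝔄) = 1 := u.inv_mul
  have hqD : Commute q D := hpD.units_inv_left
  have hq_sa : IsSelfAdjoint q := by
    rw [IsSelfAdjoint, hq, ← Units.coe_star, star_inv,
      show star u = u from Units.ext hp.isSelfAdjoint.star_eq]
  set f := D * q with hf
  have hf_sa : IsSelfAdjoint f := by
    rw [IsSelfAdjoint, hf, star_mul, hD.star_eq, hq_sa.star_eq, hqD.eq]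
  have hfu : f * u = D := by rw [hf, mul_assoc, hqp, mul_one]
  have huf : u * f = D := by rw [hf, ← mul_assoc, hpD.eq, mul_assoc, hpq, mul_one]
  have hfD : f * D = u := by
    rw [hf, ← hqD.eq, mul_assoc, ← hpp, ← mul_assoc, hqp, one_mul]
  have hDf : D * f = u := by
    rw [hf, ← mul_assoc, ← hpp, mul_assoc, hpq, mul_one]
  have hff : f * f = 1 := by
    calc f * f = f * D * q := by rw [mul_assoc f, ← hf]
      _ = 1 := by rw [hfD, hpq]
  clear_value f
  have hE : IsSelfAdjoint (f * a - a * f) := by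
    rw [IsSelfAdjoint, star_sub, star_mul, star_mul, ha, hf_sa.star_eq]
    noncomm_ring
  have hX : IsSelfAdjoint (D * a - a * D) := by
    rw [IsSelfAdjoint, star_sub, star_mul, star_mul, ha, hD.star_eq]
    noncomm_ring
  set x := D * a - a * D with hx
  set c := ‖x‖
  have hxle : x ≤ c • 1 := by
    simpa [Algebra.algebraMap_eq_smul_one] using hX.le_algebraMap_norm_self
  have hlex : -(c • 1) ≤ x := by
    simpa [Algebra.algebraMap_eq_smul_one] using hX.neg_algebraMap_norm_le_self
  have hfxle : f * x * f ≤ c • 1 := by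
    simpa [hff] using hf_sa.conjugate_le_conjugate hxle
  have hlefx : -(c • 1) ≤ f * x * f := by
    simpa [hff] using hf_sa.conjugate_le_conjugate hlex
  have hlyap : u * (f * a - a * f) + (f * a - a * f) * u = x - f * x * f := by
    have h₁ : u * (f * a - a * f) = D * a - u * a * f := by
      rw [mul_sub, ← mul_assoc, huf, ← mul_assoc]
    have h₂ : (f * a - a * f) * u = f * a * u - a * D := by
      rw [sub_mul, mul_assoc a, hfu]
    have h₃ : f * x * f = u * a * f - f * a * u := by
      rw [hx, mul_sub, sub_mul, ← mul_assoc, hfD, ← mul_assoc f a D, mul_assoc (f * a), hDf]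
    rw [h₁, h₂, h₃, hx]
    abel
  have hcq : IsSelfAdjoint (c • q) := IsSelfAdjoint.smul (.all c) hq_sa
  have hjordan : u * (c • q) + c • q * u = c • 1 + c • (1 : 𝔄) := by
    rw [mul_smul_comm, smul_mul_assoc, hpq, hqp]
  refine ⟨hE, ?_, ?_⟩
  · rw [neg_le_iff_add_nonneg]
    refine nonneg_of_mul_add_mul_nonneg hp (hE.add hcq) ?_
    convert add_nonneg (neg_le_iff_add_nonneg.1 hlex) (sub_nonneg.2 hfxle) using 1
    calc _ = (u * (f * a - a * f) + (f * a - a * f) * u) + (u * (c • q) + c • q * u) := by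
          rw [mul_add, add_mul]; abel
      _ = _ := by rw [hlyap, hjordan]; abel
  · rw [← sub_nonneg]
    refine nonneg_of_mul_add_mul_nonneg hp (hcq.sub hE) ?_
    convert add_nonneg (neg_le_iff_add_nonneg.1 hlefx) (sub_nonneg.2 hxle) using 1
    calc _ = (u * (c • q) + c • q * u) - (u * (f * a - a * f) + (f * a - a * f) * u) := by
          rw [mul_sub, sub_mul]; abel
      _ = _ := by rw [hlyap, hjordan]; abel
end

section
/- With N, D, d and the operations Ŝ^k as in the context, for every k ≥ 1: (i) Ŝ^k(a_0,…,a_n) = 0 whenever n ≤ 2k−1 (i.e. the tuple has at most 2k entries); and (ii) for any a_0,…,a_{2k} ∈ N, Ŝ^k(a_0,…,a_{2k}) = k · Ŝ^{k−1}(a_0,…,a_{2k−2}) · a_{2k−1} · a_{2k}. -/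
/-- The operations `Ŝ^k` of the Appendix of the paper, defined by recursion on `k`:
`Ŝ^0(a_0,…,a_n) = a_0 d(a_1)⋯d(a_n)` where `d(x) = Dx − xD`, and for `k ≥ 1`
`Ŝ^k(a_0,…,a_n) = Σ_{j=0}^{k−1} binom(k−1,j) Σ_{i=1}^{n−1}
Ŝ^j(a_0,…,a_{i−1}) · Ŝ^{k−1−j}(a_i a_{i+1}, a_{i+2},…,a_n)`.
(Indices out of the intended range are clamped with `min`, which does not affect the
values actually used.) -/
def Shat {N : Type*} [Ring N] (D : N) : (k : ℕ) → (n : ℕ) → (Fin (n + 1) → N) → N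
  | 0, n, a => a 0 * (List.ofFn fun i : Fin n => D * a i.succ - a i.succ * D).prod
  | k + 1, n, a =>
    ∑ j ∈ (Finset.range (k + 1)).attach,
      (k.choose j.1) •
        ∑ i ∈ Finset.Ico 1 n,
          Shat D j.1 (i - 1)
              (fun t => a ⟨min t n, Nat.lt_succ_of_le (Nat.min_le_right _ _)⟩) *
            Shat D (k - j.1) (n - i - 1)
              (fun t =>
                if (t : ℕ) = 0 then
                  a ⟨min i n, Nat.lt_succ_of_le (Nat.min_le_right _ _)⟩ *
                    a ⟨min (i + 1) n, Nat.lt_succ_of_le (Nat.min_le_right _ _)⟩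
                else a ⟨min (i + 1 + t) n, Nat.lt_succ_of_le (Nat.min_le_right _ _)⟩)
  termination_by k => k
  decreasing_by
  · have := j.2; simp only [Finset.mem_range] at this; omega
  · omega

/-- The sequence `a_i a_{i+1}, a_{i+2}, a_{i+3}, …`. -/
def mergeSeq {M : Type*} [Mul M] (a : ℕ → M) (i s : ℕ) : M :=
  if s = 0 then a i * a (i + 1) else a (i + 1 + s)

/-- The defining recursion of `Shat` for tuples that are initial segments of a sequence. -/
theorem Shat_succ_seq {N : Type*} [Ring N] (D : N) (k n : ℕ) (a : ℕ → N) :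
    Shat D (k + 1) n (fun t => a t) =
      ∑ j ∈ Finset.range (k + 1), k.choose j • ∑ i ∈ Finset.Ico 1 n,
        Shat D j (i - 1) (fun t => a t) *
          Shat D (k - j) (n - i - 1) (fun t => mergeSeq a i t) := by
  rw [Shat, ← Finset.sum_attach (Finset.range (k + 1))]
  refine Finset.sum_congr rfl fun j _ => congrArg _ (Finset.sum_congr rfl fun i hi => ?_)
  rw [Finset.mem_Ico] at hi
  congr 2
  · funext t
    have := t.isLt
    simp only
    congr 1
    omega
  · funext t
    have := t.isLt
    simp only [mergeSeq, min_eq_left (show i ≤ n by omega), min_eq_left (show i + 1 ≤ n by omega),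
      min_eq_left (show i + 1 + (t : ℕ) ≤ n by omega)]

theorem Shat_seq_eq_zero {N : Type*} [Ring N] (D : N) (k : ℕ) :
    ∀ (n : ℕ) (a : ℕ → N), n < 2 * k → Shat D k n (fun t => a t) = 0 := by
  induction k using Nat.strong_induction_on with
  | _ k ih =>
    intro n a hn
    obtain _ | k := k
    · omega
    rw [Shat_succ_seq]
    refine Finset.sum_eq_zero fun j hj => ?_
    rw [Finset.mem_range] at hj
    rw [Finset.sum_eq_zero, smul_zero]
    intro i hi
    rw [Finset.mem_Ico] at hi
    by_cases h : i - 1 < 2 * j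
    · rw [ih j hj _ _ h, zero_mul]
    · rw [ih (k - j) (by omega) (n - i - 1) _ (by omega), mul_zero]

theorem prod_map_range_mul_prod_merge {M : Type*} [Monoid M] (a : ℕ → M) (i m : ℕ) :
    ((List.range i).map a).prod *
        ((List.range (m + 1)).map (mergeSeq a i)).prod =
      ((List.range (i + m + 2)).map a).prod := by
  induction m with
  | zero => simp [mergeSeq, List.range_succ]
  | succ m ih =>
    rw [List.range_succ, List.map_append, List.prod_append, ← mul_assoc, ih,
      show i + (m + 1) + 2 = (i + m + 2) + 1 by omega, List.range_succ (n := i + m + 2)]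
    simp [mergeSeq, show i + 1 + (m + 1) = i + m + 2 by omega]

/-- On tuples with `2k + 1` entries, `Ŝ^k` is `k!` times the ordered product of the entries. -/
theorem Shat_seq_top {N : Type*} [Ring N] (D : N) (k : ℕ) :
    ∀ a : ℕ → N, Shat D k (2 * k) (fun t => a t) =
      k.factorial • ((List.range (2 * k + 1)).map a).prod := by
  induction k using Nat.strong_induction_on with
  | _ k ih =>
    intro a
    obtain _ | k := k
    · simp [Shat]
    rw [Shat_succ_seq, Finset.sum_congr rfl
      (g := fun _ => k.factorial • ((List.range (2 * (k + 1) + 1)).map a).prod)]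
    · rw [Finset.sum_const, Finset.card_range, Nat.factorial_succ, mul_smul]
    intro j hj
    rw [Finset.mem_range] at hj
    rw [Finset.sum_eq_single_of_mem (2 * j + 1) (by rw [Finset.mem_Ico]; omega)]
    · rw [show 2 * (k + 1) - (2 * j + 1) - 1 = 2 * (k - j) by omega, Nat.add_sub_cancel,
        ih j hj, ih (k - j) (by omega), smul_mul_smul_comm, prod_map_range_mul_prod_merge,
        smul_smul, ← mul_assoc, Nat.choose_mul_factorial_mul_factorial (by omega),
        show 2 * j + 1 + 2 * (k - j) + 2 = 2 * (k + 1) + 1 by omega]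
    · intro i hi hne
      rw [Finset.mem_Ico] at hi
      by_cases h : i - 1 < 2 * j
      · rw [Shat_seq_eq_zero D j _ _ h, zero_mul]
      · rw [Shat_seq_eq_zero D (k - j) (2 * (k + 1) - i - 1) _ (by omega), mul_zero]

/-- Every nonempty tuple is an initial segment of a sequence. -/
theorem exists_seq_extension {N : Type*} (n : ℕ) (a : Fin (n + 1) → N) :
    ∃ b : ℕ → N, a = fun t : Fin (n + 1) => b t :=
  ⟨fun t => a (Fin.ofNat (n + 1) t), by funext t; simp⟩

/-- (i) `Ŝ^k` vanishes on tuples with at most `2k` entries, and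
(ii) `Ŝ^k(a_0,…,a_{2k}) = k · Ŝ^{k−1}(a_0,…,a_{2k−2}) · a_{2k−1} · a_{2k}`. -/
theorem Shat_eq_zero_and_Shat_top
    {N : Type*} [Ring N] [Algebra ℂ N] (D : N) (k : ℕ) (hk : 1 ≤ k) :
    (∀ n : ℕ, n ≤ 2 * k - 1 → ∀ a : Fin (n + 1) → N, Shat D k n a = 0) ∧
      (∀ a : Fin (2 * k + 1) → N,
        Shat D k (2 * k) a
          = k • (Shat D (k - 1) (2 * k - 2)
                (fun t => a ⟨t, lt_of_lt_of_le t.isLt (by omega)⟩)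
              * a ⟨2 * k - 1, by omega⟩ * a ⟨2 * k, by omega⟩)) := by
  refine ⟨fun n hn a => ?_, fun a => ?_⟩
  · obtain ⟨b, rfl⟩ := exists_seq_extension n a
    exact Shat_seq_eq_zero D k n b (by omega)
  · obtain ⟨b, rfl⟩ := exists_seq_extension (2 * k) a
    obtain ⟨k, rfl⟩ := Nat.exists_eq_add_of_le' hk
    refine (Shat_seq_top D (k + 1) b).trans ?_
    have h : Shat D k (2 * (k + 1) - 2) (fun t => b t) = _ := Shat_seq_top D k b
    simp only [Nat.add_sub_cancel, show 2 * (k + 1) - 1 = 2 * k + 1 by omega]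
    rw [h, show 2 * (k + 1) + 1 = 2 * k + 1 + 1 + 1 by omega, List.range_succ,
      List.range_succ (n := 2 * k + 1), Nat.factorial_succ, mul_smul]
    simp [mul_add, mul_assoc]
end

section
/- With N, D, d and the operations Ŝ^k as in the context, for every k ≥ 1, every n ≥ 2 and all a_0,…,a_n ∈ N: Ŝ^k(a_0,…,a_{n−1}) · d(a_n) = Ŝ^k(a_0,…,a_n) − k · Ŝ^{k−1}(a_0,…,a_{n−2}) · a_{n−1} · a_n. -/
/-- `Ŝ^k` of the first `n + 1` entries of a sequence. -/
def ShatSeq {N : Type*} [Ring N] (D : N) (k n : ℕ) (f : ℕ → N) : N :=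
  Shat D k n fun t => f t

/-- The sequence `(f i * f (i + 1), f (i + 2), f (i + 3), …)`. -/
def mergeTail {N : Type*} [Ring N] (f : ℕ → N) (i : ℕ) : ℕ → N :=
  fun t => if t = 0 then f i * f (i + 1) else f (i + 1 + t)

/-- The inner sum in the recursion defining `Ŝ^k`, with fixed orders `j` and `p` of the factors. -/
def ShatConv {N : Type*} [Ring N] (D : N) (f : ℕ → N) (j p n : ℕ) : N :=
  ∑ i ∈ Finset.Ico 1 n, ShatSeq D j (i - 1) f * ShatSeq D p (n - i - 1) (mergeTail f i)

section

variable {N : Type*} [Ring N] (D : N)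

lemma mergeTail_of_pos (f : ℕ → N) (i : ℕ) {t : ℕ} (ht : 0 < t) :
    mergeTail f i t = f (i + 1 + t) :=
  if_neg ht.ne'

lemma ShatSeq_zero_zero (f : ℕ → N) : ShatSeq D 0 0 f = f 0 := by
  simp [ShatSeq, Shat]

lemma ShatSeq_zero_succ (n : ℕ) (f : ℕ → N) :
    ShatSeq D 0 (n + 1) f = ShatSeq D 0 n f * (D * f (n + 1) - f (n + 1) * D) := by
  simp only [ShatSeq, Shat]
  rw [List.ofFn_succ', List.concat_eq_append, List.prod_append]
  simp [mul_assoc]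

lemma ShatSeq_succ (k n : ℕ) (f : ℕ → N) :
    ShatSeq D (k + 1) n f = ∑ j ∈ Finset.range (k + 1), k.choose j • ShatConv D f j (k - j) n := by
  rw [ShatSeq, Shat, Finset.sum_attach (Finset.range (k + 1)) (fun j => k.choose j •
    ∑ i ∈ Finset.Ico 1 n, Shat D j (i - 1) (fun t => f (min t n)) *
      Shat D (k - j) (n - i - 1) (fun t => if (t : ℕ) = 0 then f (min i n) * f (min (i + 1) n)
        else f (min (i + 1 + t) n)))]
  refine Finset.sum_congr rfl fun j _ => ?_
  refine congrArg _ (Finset.sum_congr rfl fun i hi => ?_)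
  rw [Finset.mem_Ico] at hi
  simp only [ShatSeq, mergeTail]
  congr 2
  · funext t
    rw [min_eq_left (by omega)]
  · funext t
    rw [min_eq_left (by omega : i ≤ n), min_eq_left (by omega : i + 1 ≤ n),
      min_eq_left (by omega : i + 1 + (t : ℕ) ≤ n)]

lemma ShatSeq_succ_zero (k : ℕ) (f : ℕ → N) : ShatSeq D (k + 1) 0 f = 0 := by
  simp [ShatSeq_succ, ShatConv]

lemma ShatSeq_succ_one (k : ℕ) (f : ℕ → N) : ShatSeq D (k + 1) 1 f = 0 := by
  simp [ShatSeq_succ, ShatConv]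

lemma sum_choose_smul_ShatConv (k n : ℕ) (f : ℕ → N) :
    ∑ j ∈ Finset.range (k + 1), k.choose j • (k - j) • ShatConv D f j (k - j - 1) n =
      k • ShatSeq D k n f := by
  cases k with
  | zero => simp
  | succ k =>
    rw [Finset.sum_range_succ, Nat.sub_self, zero_smul, smul_zero, add_zero, ShatSeq_succ,
      Finset.smul_sum]
    refine Finset.sum_congr rfl fun j _ => ?_
    rw [smul_smul, smul_smul, ← Nat.choose_mul_succ_eq, mul_comm,
      show k + 1 - j - 1 = k - j by omega]

lemma sum_choose_smul_mul_ShatSeq_zero (k n : ℕ) (f : ℕ → N) (g : ℕ → N) :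
    ∑ j ∈ Finset.range (k + 1), k.choose j • (ShatSeq D j n f * ShatSeq D (k - j) 0 g) =
      ShatSeq D k n f * g 0 := by
  rw [Finset.sum_range_succ, Finset.sum_eq_zero, zero_add, Nat.choose_self, one_smul,
    Nat.sub_self, ShatSeq_zero_zero]
  intro j hj
  rw [Finset.mem_range] at hj
  obtain ⟨p, hp⟩ : ∃ p, k - j = p + 1 := ⟨k - j - 1, by omega⟩
  rw [hp, ShatSeq_succ_zero, mul_zero, smul_zero]

/-- If `Ŝ^p` satisfies the product formula, then so does the inner sum `ShatConv`. -/
lemma ShatConv_mul_d {p : ℕ} (hp : ∀ (m : ℕ) (g : ℕ → N),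
      ShatSeq D p (m + 1) g * (D * g (m + 2) - g (m + 2) * D) =
        ShatSeq D p (m + 2) g - p • (ShatSeq D (p - 1) m g * (g (m + 1) * g (m + 2))))
    (j n : ℕ) (f : ℕ → N) :
    ShatConv D f j p (n + 1) * (D * f (n + 2) - f (n + 2) * D) =
      ShatConv D f j p (n + 2) - ShatSeq D j n f * ShatSeq D p 0 (mergeTail f (n + 1)) -
        p • (ShatConv D f j (p - 1) n * (f (n + 1) * f (n + 2))) := by
  have h_last : ∀ g : ℕ → N, ShatSeq D p 0 g * (D * g 1 - g 1 * D) = ShatSeq D p 1 g := by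
    intro g
    cases p with
    | zero => rw [ShatSeq_zero_succ]
    | succ p => rw [ShatSeq_succ_zero, ShatSeq_succ_one, zero_mul]
  have h_top : ShatConv D f j p (n + 2) =
      ∑ i ∈ Finset.Ico 1 (n + 1),
        ShatSeq D j (i - 1) f * ShatSeq D p (n + 1 - i) (mergeTail f i) +
      ShatSeq D j n f * ShatSeq D p 0 (mergeTail f (n + 1)) := by
    rw [ShatConv, Finset.sum_Ico_succ_top (by omega)]
    congr 1
    · refine Finset.sum_congr rfl fun i _ => ?_
      rw [show n + 2 - i - 1 = n + 1 - i by omega]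
    · rw [show n + 2 - (n + 1) - 1 = 0 by omega, Nat.add_sub_cancel]
  rw [h_top, add_sub_cancel_right, ShatConv, ShatConv]
  cases n with
  | zero => simp
  | succ n =>
    rw [Finset.sum_Ico_succ_top (by omega : 1 ≤ n + 1),
      Finset.sum_Ico_succ_top (by omega : 1 ≤ n + 1), add_mul, Finset.sum_mul, Finset.sum_mul,
      Finset.smul_sum, add_sub_right_comm, ← Finset.sum_sub_distrib]
    congr 1
    · refine Finset.sum_congr rfl fun i hi => ?_
      rw [Finset.mem_Ico] at hi
      obtain ⟨m, rfl⟩ : ∃ m, n = i + m := ⟨n - i, by omega⟩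
      have h := hp m (mergeTail f i)
      rw [mergeTail_of_pos f i (by omega : 0 < m + 2),
        mergeTail_of_pos f i (by omega : 0 < m + 1)] at h
      rw [show i + m + 1 + 1 - i - 1 = m + 1 by omega, show i + m + 1 + 1 - i = m + 2 by omega,
        show i + m + 1 - i - 1 = m by omega, show i + m + 1 + 2 = i + 1 + (m + 2) by omega,
        show i + m + 1 + 1 = i + 1 + (m + 1) by omega, mul_assoc, h, mul_sub, mul_smul_comm,
        mul_assoc]
    · have h := h_last (mergeTail f (n + 1))
      rw [mergeTail_of_pos f (n + 1) one_pos] at h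
      rw [show n + 1 + 1 - (n + 1) - 1 = 0 by omega, show n + 1 + 1 - (n + 1) = 1 by omega,
        mul_assoc, show n + 1 + 2 = n + 1 + 1 + 1 from rfl, h]

/-- The product formula for sequences. -/
lemma ShatSeq_mul_d (k n : ℕ) (f : ℕ → N) :
    ShatSeq D k (n + 1) f * (D * f (n + 2) - f (n + 2) * D) =
      ShatSeq D k (n + 2) f - k • (ShatSeq D (k - 1) n f * (f (n + 1) * f (n + 2))) := by
  induction k using Nat.strong_induction_on generalizing n f with
  | _ k ih =>
    cases k with
    | zero => rw [ShatSeq_zero_succ D (n + 1), zero_smul, sub_zero]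
    | succ k =>
      have h_conv : ∀ j, _ := fun j => ShatConv_mul_d D (ih (k - j) (by omega)) j n f
      have h_sum := sum_choose_smul_mul_ShatSeq_zero D k n f (mergeTail f (n + 1))
      have h_choose := congrArg (· * (f (n + 1) * f (n + 2))) (sum_choose_smul_ShatConv D k n f)
      simp only [Finset.sum_mul, smul_mul_assoc] at h_choose
      rw [ShatSeq_succ, Finset.sum_mul]
      simp only [smul_mul_assoc, h_conv, smul_sub, Finset.sum_sub_distrib]
      rw [h_sum, h_choose, ← ShatSeq_succ, Nat.add_sub_cancel, succ_nsmul', sub_sub]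
      rfl

end

/-- `Ŝ^k(a_0,…,a_{n−1})·d(a_n) = Ŝ^k(a_0,…,a_n) − k·Ŝ^{k−1}(a_0,…,a_{n−2})·a_{n−1}·a_n`
for `k ≥ 1` and `n ≥ 2`. -/
theorem Shat_mul_d_eq
    {N : Type*} [Ring N] [Algebra ℂ N] (D : N) (k : ℕ) (hk : 1 ≤ k)
    (n : ℕ) (hn : 2 ≤ n) (a : Fin (n + 1) → N) :
    Shat D k (n - 1) (fun t => a ⟨t, lt_of_lt_of_le t.isLt (by omega)⟩)
        * (D * a ⟨n, by omega⟩ - a ⟨n, by omega⟩ * D)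
      = Shat D k n a
        - k • (Shat D (k - 1) (n - 2) (fun t => a ⟨t, lt_of_lt_of_le t.isLt (by omega)⟩)
            * a ⟨n - 1, by omega⟩ * a ⟨n, by omega⟩) := by
  obtain ⟨n, rfl⟩ : ∃ m, n = m + 2 := ⟨n - 2, by omega⟩
  have h := ShatSeq_mul_d D k n fun t => a ⟨min t (n + 2), by omega⟩
  have h_left : ∀ t : Fin (n + 2 + 1), min (t : ℕ) (n + 2) = t := fun t => by omega
  have h_left' : ∀ t : Fin (n + 1 + 1), min (t : ℕ) (n + 2) = t := fun t => by omega
  have h_left'' : ∀ t : Fin (n + 1), min (t : ℕ) (n + 2) = t := fun t => by omega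
  simp only [ShatSeq, h_left, h_left', h_left'', min_self,
    min_eq_left (by omega : n + 1 ≤ n + 2)] at h
  rw [← mul_assoc] at h
  exact h
end
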